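/- Fix an integer j₀ ≥ 2 and define a_n = −exp(−√(log(n+j₀))), z_n = (n+j₀)³, r_n = a_{n+1} − a_n, and p_n = (z_{n+1} − z_n)·r_n for n ≥ 1. Then for all real α, β, γ > 0, lim_{n→∞} exp(−p_n)·z_{n+1}^α·p_n^β·r_n^{−γ} = 0. -/

import Mathlib

/-- The sequence `a_n = -exp(-√(log(n+j₀)))`. -/
noncomputable def aSeq (j₀ n : ℕ) : ℝ :=
  -Real.exp (-Real.sqrt (Real.log ((n : ℝ) + (j₀ : ℝ))))

/-- The sequence `r_n = a_{n+1} - a_n`. -/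
noncomputable def rSeq (j₀ n : ℕ) : ℝ := aSeq j₀ (n + 1) - aSeq j₀ n

/-- The sequence `z_n = (n+j₀)³`. -/
noncomputable def zSeq (j₀ n : ℕ) : ℝ := ((n : ℝ) + (j₀ : ℝ)) ^ 3

/-- The sequence `p_n = (z_{n+1} - z_n) r_n`. -/
noncomputable def pSeq (j₀ n : ℕ) : ℝ := (zSeq j₀ (n + 1) - zSeq j₀ n) * rSeq j₀ n

open Real in
lemma r_bounds (x : ℝ) (hx : 1 ≤ x) :
    exp (-2) / 2 * (√(x + 1) ^ 3)⁻¹ ≤ -exp (-√(log (x + 1))) - -exp (-√(log x)) ∧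
    -exp (-√(log (x + 1))) - -exp (-√(log x)) ≤ 1 := by
  have hlx : 0 ≤ log x := log_nonneg hx
  have hly : 0 < log (x + 1) := log_pos (by linarith)
  set s := √(log x) with hs
  set t := √(log (x + 1)) with ht
  have hs0 : 0 ≤ s := sqrt_nonneg _
  have ht0 : 0 < t := sqrt_pos.2 hly
  have hs2 : s ^ 2 = log x := sq_sqrt hlx
  have ht2 : t ^ 2 = log (x + 1) := sq_sqrt hly.le
  have hst : s ≤ t := sqrt_le_sqrt (log_le_log (by linarith) (by linarith))
  constructor
  · have h1 : (x + 1)⁻¹ ≤ t ^ 2 - s ^ 2 := by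
      rw [hs2, ht2, ← log_div (by linarith) (by linarith)]
      have := one_sub_inv_le_log_of_pos (x := (x + 1) / x) (by positivity)
      refine le_trans (le_of_eq ?_) this
      have : x ≠ 0 := by linarith
      have : x + 1 ≠ 0 := by linarith
      field_simp
      ring
    have h2 : (x + 1)⁻¹ / (2 * t) ≤ t - s := by
      rw [div_le_iff₀ (by positivity)]
      nlinarith
    have h3 : exp (-t) * (t - s) ≤ exp (-s) - exp (-t) := by
      have e : exp (-s) = exp (-t) * exp (t - s) := by rw [← exp_add]; ring_nf
      rw [e]
      nlinarith [add_one_le_exp (t - s), exp_pos (-t)]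
    have h4 : exp (-t) ≤ t⁻¹ := by
      rw [exp_neg]
      exact inv_anti₀ ht0 (by linarith [add_one_le_exp t])
    have hy : √(x + 1) = exp (t ^ 2 / 2) := by
      rw [ht2, ← log_sqrt (by linarith), exp_log (sqrt_pos.2 (by linarith))]
    have hy2 : x + 1 = exp (t ^ 2) := by rw [ht2, exp_log (by linarith)]
    have h5 : exp (-2) * (√(x + 1) ^ 3)⁻¹ ≤ exp (-t) * exp (-t) * (x + 1)⁻¹ := by
      rw [hy, hy2, ← exp_nat_mul, ← exp_neg, ← exp_neg, ← exp_add, ← exp_add, ← exp_add]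
      apply exp_le_exp.2
      push_cast
      nlinarith [sq_nonneg (t - 2)]
    have hi : 0 < (x + 1)⁻¹ := by positivity
    calc exp (-2) / 2 * (√(x + 1) ^ 3)⁻¹ = (exp (-2) * (√(x + 1) ^ 3)⁻¹) / 2 := by ring
      _ ≤ (exp (-t) * exp (-t) * (x + 1)⁻¹) / 2 := by gcongr
      _ ≤ (exp (-t) * t⁻¹ * (x + 1)⁻¹) / 2 := by gcongr
      _ = exp (-t) * ((x + 1)⁻¹ / (2 * t)) := by field_simp
      _ ≤ exp (-t) * (t - s) := by gcongr
      _ ≤ _ := by linarith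
  · have := exp_pos (-t)
    have : exp (-s) ≤ 1 := exp_le_one_iff.2 (by linarith)
    linarith

/-- Fix an integer `j₀ ≥ 2`. Then for all real `α, β, γ > 0`,
`lim_n exp(−p_n) z_{n+1}^α p_n^β r_n^{−γ} = 0`. -/
theorem stmt_17 (j₀ : ℕ) (hj₀ : 2 ≤ j₀) :
    ∀ α β γ : ℝ, 0 < α → 0 < β → 0 < γ →
      Filter.Tendsto
        (fun n : ℕ => Real.exp (-pSeq j₀ n) *
          zSeq j₀ (n + 1) ^ α * pSeq j₀ n ^ β * rSeq j₀ n ^ (-γ))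
        Filter.atTop (nhds 0) := by
  intro α β γ hα hβ hγ
  set c : ℝ := Real.exp (-2) / 2 with hc
  have hc0 : 0 < c := by positivity
  set u : ℕ → ℝ := fun n => √((n : ℝ) + j₀ + 1) with hu
  have hut : Filter.Tendsto u Filter.atTop Filter.atTop := by
    apply Real.tendsto_sqrt_atTop.comp
    apply Filter.tendsto_atTop_add_const_right
    apply Filter.tendsto_atTop_add_const_right
    exact tendsto_natCast_atTop_atTop
  have hlim := ((tendsto_rpow_mul_exp_neg_mul_atTop_nhds_zero
    (6 * α + 4 * β + 3 * γ) c hc0).comp hut).const_mul (3 ^ β * c ^ (-γ))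
  rw [mul_zero] at hlim
  have key : ∀ n : ℕ, 0 < u n ∧ c * (u n ^ 3)⁻¹ ≤ rSeq j₀ n ∧ c * u n ≤ pSeq j₀ n ∧
      pSeq j₀ n ≤ 3 * u n ^ 4 ∧ zSeq j₀ (n + 1) = u n ^ 6 := by
    intro n
    have hj : (2 : ℝ) ≤ j₀ := by exact_mod_cast hj₀
    have hn : (0 : ℝ) ≤ n := Nat.cast_nonneg n
    obtain ⟨h1, h2⟩ := r_bounds ((n : ℝ) + j₀) (by linarith)
    have hr : rSeq j₀ n = -Real.exp (-√(Real.log ((n : ℝ) + j₀ + 1))) -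
        -Real.exp (-√(Real.log ((n : ℝ) + j₀))) := by
      unfold rSeq aSeq
      push_cast
      rw [add_right_comm]
    rw [← hr] at h1 h2
    have hu0 : 0 < u n := Real.sqrt_pos.2 (by linarith)
    have hu2 : u n ^ 2 = (n : ℝ) + j₀ + 1 := Real.sq_sqrt (by linarith)
    change c * (u n ^ 3)⁻¹ ≤ _ at h1
    have hz1 : zSeq j₀ (n + 1) = u n ^ 6 := by
      rw [show u n ^ 6 = (u n ^ 2) ^ 3 by ring, hu2]
      unfold zSeq
      push_cast
      ring
    have hz0 : zSeq j₀ n = (u n ^ 2 - 1) ^ 3 := by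
      rw [hu2]
      unfold zSeq
      ring
    have hu1 : 1 ≤ u n ^ 2 := by linarith
    have hd1 : u n ^ 4 ≤ zSeq j₀ (n + 1) - zSeq j₀ n := by
      rw [hz1, hz0]
      nlinarith
    have hd2 : zSeq j₀ (n + 1) - zSeq j₀ n ≤ 3 * u n ^ 4 := by
      rw [hz1, hz0]
      nlinarith
    have hr0 : 0 < rSeq j₀ n := lt_of_lt_of_le (by positivity) h1
    refine ⟨hu0, h1, ?_, ?_, hz1⟩
    · calc c * u n = u n ^ 4 * (c * (u n ^ 3)⁻¹) := by field_simp
        _ ≤ u n ^ 4 * rSeq j₀ n := by gcongr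
        _ ≤ _ := by unfold pSeq; gcongr
    · calc pSeq j₀ n ≤ (3 * u n ^ 4) * 1 := by unfold pSeq; gcongr
        _ = _ := by ring
  refine squeeze_zero (fun n => ?_) (fun n => ?_) hlim
  · obtain ⟨h0, h1, h2, h3, h4⟩ := key n
    have hr0 : 0 < rSeq j₀ n := lt_of_lt_of_le (by positivity) h1
    have hp0 : 0 < pSeq j₀ n := lt_of_lt_of_le (by positivity) h2
    rw [h4]
    positivity
  · obtain ⟨h0, h1, h2, h3, h4⟩ := key n
    have hr0 : 0 < rSeq j₀ n := lt_of_lt_of_le (by positivity) h1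
    have hp0 : 0 < pSeq j₀ n := lt_of_lt_of_le (by positivity) h2
    have e1 : zSeq j₀ (n + 1) ^ α = u n ^ (6 * α) := by
      rw [h4, Real.rpow_mul h0.le]
      norm_cast
    have e2 : pSeq j₀ n ^ β ≤ 3 ^ β * u n ^ (4 * β) := by
      calc pSeq j₀ n ^ β ≤ (3 * u n ^ 4) ^ β := Real.rpow_le_rpow hp0.le h3 hβ.le
        _ = _ := by
          rw [Real.mul_rpow (by norm_num) (by positivity), Real.rpow_mul h0.le]
          norm_cast
    have e3 : rSeq j₀ n ^ (-γ) ≤ c ^ (-γ) * u n ^ (3 * γ) := by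
      calc rSeq j₀ n ^ (-γ) ≤ (c * (u n ^ 3)⁻¹) ^ (-γ) :=
            Real.rpow_le_rpow_of_nonpos (by positivity) h1 (by linarith)
        _ = _ := by
          rw [Real.mul_rpow hc0.le (by positivity), Real.rpow_mul h0.le,
            Real.inv_rpow (by positivity), Real.rpow_neg (x := u n ^ 3) (by positivity), inv_inv]
          norm_cast
    have e4 : Real.exp (-pSeq j₀ n) ≤ Real.exp (-c * u n) :=
      Real.exp_le_exp.2 (by linarith)
    rw [e1]
    calc _ ≤ Real.exp (-c * u n) * u n ^ (6 * α) * (3 ^ β * u n ^ (4 * β)) *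
          (c ^ (-γ) * u n ^ (3 * γ)) := by gcongr
      _ = _ := by
        simp only [Function.comp]
        rw [Real.rpow_add h0, Real.rpow_add h0]
        ring
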